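/- Let 0 < a ≤ 1 and define Z(s₁,s₂;a) := a^{-s₁} (ζ(s₂,a) − a^{-s₂}) + (ζ(s₁+s₂−1,a) − a^{1−s₁−s₂})/(s₂−1) − (ζ(s₁+s₂,a) − a^{-s₁-s₂})/2 − ∑_{n=1}^∞ Φ₀(s₂ | n,a) (n+a)^{-s₁}, where Φ₀(s | λ,a) := s ∫_λ^∞ (x − ⌊x⌋ − 1/2)/(x+a)^{s+1} dx; Z(s₁,s₂;a) is the analytic continuation of the double series ζ₂(s₁,s₂;a). Then Z(σ₁,σ₂;a) ≠ 0 for all real σ₁, σ₂ with 0 < σ₁ < 1, σ₂ > 1 and 1 < σ₁ + σ₂ < 2, if and only if a ≥ 1/2. -/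

import Mathlib

open Set HurwitzZeta

/-- `Φ₀(s | λ, a) = s ∫_λ^∞ (x - ⌊x⌋ - 1/2)/(x+a)^(s+1) dx`. -/
noncomputable def Phi0 (s : ℂ) (lam a : ℝ) : ℂ :=
  s * ∫ x in Ioi lam, ((x - (⌊x⌋ : ℝ) - 1 / 2 : ℝ) : ℂ) / ((x + a : ℝ) : ℂ) ^ (s + 1)

/-- The Akiyama–Ishikawa analytic continuation of the Hurwitz type
Euler–Zagier double zeta function. -/
noncomputable def doubleZetaCont (a : ℝ) (s₁ s₂ : ℂ) : ℂ :=
  (a : ℂ) ^ (-s₁) * (hurwitzZeta (a : UnitAddCircle) s₂ - (a : ℂ) ^ (-s₂)) +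
    (hurwitzZeta (a : UnitAddCircle) (s₁ + s₂ - 1) - (a : ℂ) ^ (1 - s₁ - s₂)) / (s₂ - 1) -
    (hurwitzZeta (a : UnitAddCircle) (s₁ + s₂) - (a : ℂ) ^ (-s₁ - s₂)) / 2 -
    ∑' n : ℕ, Phi0 s₂ (n + 1 : ℕ) a * (((n : ℂ) + 1) + a) ^ (-s₁)

open Filter Topology

/-- `∑ f` is bounded by `g 0` if `f` is bounded by the decrements of `g` and `g` is asymptotically
nonnegative. -/
lemma HasSum.le_of_le_sub_succ {f g : ℕ → ℝ} {L : ℝ} (hf : HasSum f L)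
    (hfg : ∀ n, f n ≤ g n - g (n + 1)) (hg : ∀ ε > 0, ∀ᶠ n in atTop, -ε ≤ g n) : L ≤ g 0 := by
  have hpartial (N : ℕ) : ∑ n ∈ Finset.range N, f n ≤ g 0 - g N := by
    rw [← Finset.sum_range_sub']
    exact Finset.sum_le_sum fun n _ ↦ hfg n
  refine le_of_forall_pos_le_add fun ε hε ↦ le_of_tendsto hf.tendsto_sum_nat ?_
  filter_upwards [hg ε hε] with N hN
  linarith [hpartial N]

lemma HasSum.lt_of_lt_sub_succ {f g : ℕ → ℝ} {L : ℝ} (hf : HasSum f L)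
    (hfg : ∀ n, f n < g n - g (n + 1)) (hg : ∀ n, 0 ≤ g n) : L < g 0 := by
  have h1 : HasSum (fun n ↦ f (n + 1)) (L - f 0) := by
    simpa using (hasSum_nat_add_iff' (f := f) 1).mpr hf
  have h2 := h1.le_of_le_sub_succ (g := fun n ↦ g (n + 1)) (fun n ↦ (hfg (n + 1)).le)
    fun ε hε ↦ Eventually.of_forall fun n ↦ by linarith [hg (n + 1)]
  linarith [hfg 0]

/-- The graph of `x ↦ x ^ (-q)` lies strictly above its tangent line at `b`. -/
lemma Real.tangent_lt_rpow_neg {q b x : ℝ} (hq : 0 < q) (hq' : q ≤ 1) (hb : 0 < b) (hx : 0 < x)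
    (hxb : x ≠ b) : b ^ (-q) - q * (x - b) * b ^ (-q - 1) < x ^ (-q) := by
  set y := x / b - 1 with hy
  have hy1 : -1 < y := by
    have : 0 < x / b := by positivity
    linarith
  have hy0 : y ≠ 0 := by
    rw [hy, sub_ne_zero]
    exact fun h ↦ hxb ((div_eq_one_iff_eq hb.ne').mp h)
  have hxy : x = b * (1 + y) := by rw [hy]; field_simp; ring
  have hbern : (1 + y) ^ q ≤ 1 + q * y := rpow_one_add_le_one_add_mul_self hy1.le hq.le hq'
  have hpos : 0 < (1 + y) ^ q := Real.rpow_pos_of_pos (by linarith) _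
  have key : 1 - q * y < (1 + y) ^ (-q) := by
    rw [Real.rpow_neg (by linarith), ← one_div, lt_div_iff₀ hpos]
    rcases le_or_gt (1 - q * y) 0 with h | h
    · exact (mul_nonpos_of_nonpos_of_nonneg h hpos.le).trans_lt one_pos
    · have : 0 < (q * y) ^ 2 := by positivity
      nlinarith
  have hbq : 0 < b ^ (-q) := Real.rpow_pos_of_pos hb _
  rw [hxy, Real.mul_rpow hb.le (by linarith), Real.rpow_sub_one hb.ne']
  calc _ = b ^ (-q) * (1 - q * y) := by field_simp; ring
    _ < _ := by gcongr

lemma Real.rpow_neg_midpoint_lt {q c t : ℝ} (hq : 0 < q) (hq' : q ≤ 1) (ht : 0 < t) (htc : t < c) :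
    2 * c ^ (-q) < (c + t) ^ (-q) + (c - t) ^ (-q) := by
  have h1 := Real.tangent_lt_rpow_neg hq hq' (ht.trans htc) (x := c + t) (by linarith) (by linarith)
  have h2 := Real.tangent_lt_rpow_neg hq hq' (ht.trans htc) (x := c - t) (by linarith) (by linarith)
  nlinarith

/-- Midpoint (Hermite–Hadamard) inequality for `∫ x ^ (-q)` over `[c - 1/2, c + 1/2]`. -/
lemma Real.midpoint_lt_sub_rpow {q c : ℝ} (hq : 0 < q) (hq' : q < 1) (hc : 1 / 2 ≤ c) :
    (1 - q) * c ^ (-q) < (c + 1 / 2) ^ (1 - q) - (c - 1 / 2) ^ (1 - q) := by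
  let f : ℝ → ℝ := fun t ↦ (c + t) ^ (1 - q) - (c - t) ^ (1 - q) - 2 * t * ((1 - q) * c ^ (-q))
  have hmono : StrictMonoOn f (Icc 0 (1 / 2)) := by
    refine strictMonoOn_of_hasDerivWithinAt_pos (convex_Icc _ _)
      (f' := fun t ↦ (1 - q) * ((c + t) ^ (-q) + (c - t) ^ (-q) - 2 * c ^ (-q))) ?_ ?_ ?_
    · have : 0 ≤ 1 - q := by linarith
      fun_prop (disch := assumption)
    · intro t ht
      rw [interior_Icc] at ht
      have h1 : HasDerivAt (fun t : ℝ ↦ (c + t) ^ (1 - q))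
          (1 * (1 - q) * (c + t) ^ (1 - q - 1)) t :=
        ((hasDerivAt_id t).const_add c).rpow_const (Or.inl (by simp; linarith [ht.1]))
      have h2 : HasDerivAt (fun t : ℝ ↦ (c - t) ^ (1 - q))
          (-1 * (1 - q) * (c - t) ^ (1 - q - 1)) t :=
        ((hasDerivAt_id t).const_sub c).rpow_const (Or.inl (by simp; linarith [ht.2]))
      have h3 := (h1.sub h2).sub (((hasDerivAt_id t).const_mul 2).mul_const ((1 - q) * c ^ (-q)))
      refine (h3.congr_deriv ?_).hasDerivWithinAt
      rw [show 1 - q - 1 = -q by ring]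
      ring
    · intro t ht
      rw [interior_Icc] at ht
      have := Real.rpow_neg_midpoint_lt hq hq'.le ht.1 (ht.2.trans_le hc)
      exact mul_pos (by linarith) (by linarith)
  have := hmono (left_mem_Icc.mpr (by norm_num)) (right_mem_Icc.mpr (by norm_num))
    (by norm_num : (0 : ℝ) < 1 / 2)
  simp only [f] at this
  norm_num at this ⊢
  linarith

/-- Trapezoidal inequality for `∫ x ^ (-q)` over `[b, b + 1]`. -/
lemma Real.sub_rpow_le_trapezoid {q b : ℝ} (hq : 0 < q) (hq' : q < 1) (hb : 0 < b) :
    (b + 1) ^ (1 - q) - b ^ (1 - q) ≤ (1 - q) / 2 * (b ^ (-q) + (b + 1) ^ (-q)) := by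
  let f : ℝ → ℝ := fun t ↦ (1 - q) / 2 * (t * (b ^ (-q) + (b + t) ^ (-q))) - (b + t) ^ (1 - q)
  have hd (t : ℝ) (ht : 0 ≤ t) : HasDerivAt f
      ((1 - q) / 2 * (b ^ (-q) - ((b + t) ^ (-q) + q * t * (b + t) ^ (-q - 1)))) t := by
    have h1 (r : ℝ) : HasDerivAt (fun t : ℝ ↦ (b + t) ^ r) (1 * r * (b + t) ^ (r - 1)) t :=
      ((hasDerivAt_id t).const_add b).rpow_const (Or.inl (by simp; linarith))
    have h3 := (((hasDerivAt_id t).mul ((h1 (-q)).const_add (b ^ (-q)))).const_mul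
      ((1 - q) / 2)).sub (h1 (1 - q))
    refine h3.congr_deriv ?_
    rw [show 1 - q - 1 = -q by ring]
    simp only [id]
    ring
  have hmono : MonotoneOn f (Icc 0 1) := by
    refine monotoneOn_of_hasDerivWithinAt_nonneg (convex_Icc _ _)
      (fun t ht ↦ (hd t ht.1).continuousAt.continuousWithinAt)
      (fun t ht ↦ (hd t (interior_subset ht).1).hasDerivWithinAt) fun t ht ↦ ?_
    rw [interior_Icc] at ht
    have := Real.tangent_lt_rpow_neg hq hq'.le (b := b + t) (x := b) (by linarith [ht.1]) hb
      (by linarith [ht.1])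
    exact mul_nonneg (by linarith) (by linarith)
  have := hmono (left_mem_Icc.mpr zero_le_one) (right_mem_Icc.mpr zero_le_one) zero_le_one
  simp only [f] at this
  norm_num at this ⊢
  linarith

/-- Differentiability of a complex power of a shifted real variable. -/
lemma Complex.hasDerivAt_ofReal_add_cpow (w : ℂ) {b t : ℝ} (h : 0 < b + t) :
    HasDerivAt (fun t : ℝ ↦ ((b + t : ℝ) : ℂ) ^ w) (w * ((b + t : ℝ) : ℂ) ^ (w - 1)) t := by
  have h1 : HasDerivAt (fun t : ℝ ↦ ((b + t : ℝ) : ℂ)) 1 t :=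
    ((hasDerivAt_id t).const_add b).ofReal_comp
  have h2 : HasDerivAt (fun z : ℂ ↦ z ^ w) (w * ((b + t : ℝ) : ℂ) ^ (w - 1)) ((b + t : ℝ) : ℂ) := by
    simpa using (hasDerivAt_id ((b + t : ℝ) : ℂ)).cpow_const (c := w)
      (Complex.ofReal_mem_slitPlane.mpr h)
  exact (h2.comp t h1).congr_deriv (mul_one _)

/-- The `n`-th term of the Euler–Maclaurin series for `(s - 1) ζ(s, a)`, at `b = n + a`. -/
noncomputable def hurwitzTerm (b : ℝ) (s : ℂ) : ℂ :=
  (s - 1) * (b : ℂ) ^ (-s) + ((b + 1 : ℝ) : ℂ) ^ (1 - s) - (b : ℂ) ^ (1 - s)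

lemma norm_hurwitzTerm_le {b : ℝ} (hb : 0 < b) {s : ℂ} (hs : 0 < s.re) :
    ‖hurwitzTerm b s‖ ≤ ‖s - 1‖ * ‖s‖ * b ^ (-1 - s.re) := by
  have hinner (t : ℝ) (ht : t ∈ Ico (0 : ℝ) 1) :
      ‖((b + t : ℝ) : ℂ) ^ (-s) - (b : ℂ) ^ (-s)‖ ≤ ‖s‖ * b ^ (-1 - s.re) := by
    have := norm_image_sub_le_of_norm_deriv_le_segment' (a := 0) (b := t)
      (f := fun t : ℝ ↦ ((b + t : ℝ) : ℂ) ^ (-s)) (C := ‖s‖ * b ^ (-1 - s.re))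
      (fun x hx ↦ (Complex.hasDerivAt_ofReal_add_cpow (-s)
        (by linarith [hx.1] : 0 < b + x)).hasDerivWithinAt)
      (fun x hx ↦ by
        rw [norm_mul, norm_neg, Complex.norm_cpow_eq_rpow_re_of_pos (by linarith [hx.1])]
        gcongr ?_ * ?_
        simp only [Complex.sub_re, Complex.neg_re, Complex.one_re]
        rw [show -s.re - 1 = -1 - s.re by ring]
        exact Real.rpow_le_rpow_of_nonpos hb (by linarith [hx.1]) (by linarith))
      t (right_mem_Icc.mpr ht.1)
    simp only [add_zero, sub_zero] at this
    exact this.trans (mul_le_of_le_one_right (by positivity) ht.2.le)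
  have := norm_image_sub_le_of_norm_deriv_le_segment_01'
    (f := fun t : ℝ ↦ ((b + t : ℝ) : ℂ) ^ (1 - s) - (t : ℂ) * ((1 - s) * (b : ℂ) ^ (-s)))
    (f' := fun t ↦ (1 - s) * (((b + t : ℝ) : ℂ) ^ (-s) - (b : ℂ) ^ (-s)))
    (C := ‖s - 1‖ * ‖s‖ * b ^ (-1 - s.re))
    (fun t ht ↦ by
      have h1 := Complex.hasDerivAt_ofReal_add_cpow (1 - s) (by linarith [ht.1] : 0 < b + t)
      have h2 := ((hasDerivAt_id t).ofReal_comp).mul_const ((1 - s) * (b : ℂ) ^ (-s))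
      refine ((h1.sub h2).congr_deriv ?_).hasDerivWithinAt
      rw [show 1 - s - 1 = -s by ring]
      push_cast
      ring)
    (fun t ht ↦ by
      rw [norm_mul, norm_sub_rev 1 s, mul_assoc]
      gcongr
      exact hinner t ht)
  convert! this using 2
  rw [hurwitzTerm]
  push_cast
  simp only [add_zero, zero_mul, sub_zero, one_mul]
  ring

lemma differentiable_hurwitzTerm {b : ℝ} (hb : 0 < b) : Differentiable ℂ (hurwitzTerm b) := by
  have h1 : (b : ℂ) ≠ 0 := by exact_mod_cast hb.ne'
  have h2 : ((b + 1 : ℝ) : ℂ) ≠ 0 := by exact_mod_cast (by positivity : b + 1 ≠ 0)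
  unfold hurwitzTerm
  fun_prop (disch := exact Or.inl (by assumption))

lemma summable_natCast_add_rpow {a r : ℝ} (ha : 0 < a) (hr : r < -1) :
    Summable fun n : ℕ ↦ (n + a : ℝ) ^ r := by
  refine ((Real.summable_one_div_nat_add_rpow a (-r)).mpr (by linarith)).congr fun n ↦ ?_
  have : (0 : ℝ) < n + a := by positivity
  rw [abs_of_pos this, Real.rpow_neg this.le, one_div, inv_inv]

lemma summable_hurwitzTerm {a : ℝ} (ha : 0 < a) {s : ℂ} (hs : 0 < s.re) :
    Summable fun n : ℕ ↦ hurwitzTerm (n + a) s :=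
  .of_norm_bounded ((summable_natCast_add_rpow ha (by linarith)).mul_left (‖s - 1‖ * ‖s‖))
    fun n ↦ norm_hurwitzTerm_le (by positivity) hs

lemma differentiableOn_tsum_hurwitzTerm {a : ℝ} (ha : 0 < a) :
    DifferentiableOn ℂ (fun s ↦ ∑' n : ℕ, hurwitzTerm (n + a) s) {s | 0 < s.re} := by
  intro s₀ (hs₀ : 0 < s₀.re)
  obtain ⟨R, hR⟩ : ∃ R, ‖s₀‖ < R := exists_gt _
  have hR0 : 0 < R := (norm_nonneg _).trans_lt hR
  set ε := s₀.re / 2 with hε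
  have hε0 : 0 < ε := by linarith
  let U : Set ℂ := {s | ε < s.re} ∩ {s | ‖s‖ < R}
  have hU : IsOpen U := (isOpen_lt continuous_const Complex.continuous_re).inter
    (isOpen_lt continuous_norm continuous_const)
  have hsU : s₀ ∈ U := ⟨show ε < s₀.re by linarith, hR⟩
  have hsum := (((summable_natCast_add_rpow ha (by linarith : -1 - ε < -1)).add
    (summable_natCast_add_rpow ha (by linarith : -1 - R < -1))).mul_left ((R + 1) * R))
  refine ((Complex.differentiableOn_tsum_of_summable_norm hsum
    (fun n ↦ (differentiable_hurwitzTerm (by positivity)).differentiableOn) hU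
    fun n s hs ↦ ?_).differentiableAt (hU.mem_nhds hsU)).differentiableWithinAt
  have hsε : ε < s.re := hs.1
  have hsR : ‖s‖ < R := hs.2
  have hb : (0 : ℝ) < n + a := by positivity
  refine (norm_hurwitzTerm_le hb (hε0.trans hsε)).trans ?_
  have h1 : ‖s - 1‖ ≤ R + 1 := (norm_sub_le s 1).trans (by rw [norm_one]; linarith)
  gcongr
  rcases le_total 1 (n + a : ℝ) with h | h
  · have := Real.rpow_le_rpow_of_exponent_le h (by linarith : -1 - s.re ≤ -1 - ε)
    linarith [Real.rpow_nonneg hb.le (-1 - R)]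
  · have := Real.rpow_le_rpow_of_exponent_ge hb h
      (by linarith [Complex.re_le_norm s] : -1 - R ≤ -1 - s.re)
    linarith [Real.rpow_nonneg hb.le (-1 - ε)]

lemma tsum_hurwitzTerm_of_one_lt_re {a : ℝ} (ha : 0 < a) (ha' : a ≤ 1) {s : ℂ} (hs : 1 < s.re) :
    ∑' n : ℕ, hurwitzTerm (n + a) s =
      (s - 1) * hurwitzZeta (a : UnitAddCircle) s - (a : ℂ) ^ (1 - s) := by
  have h1 := (summable_hurwitzTerm ha (by linarith : 0 < s.re)).hasSum
  have h2 := (hasSum_hurwitzZeta_of_one_lt_re ⟨ha.le, ha'⟩ hs).mul_left (s - 1)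
  have h3 := h1.sub h2
  have hterm (n : ℕ) : hurwitzTerm (n + a) s - (s - 1) * (1 / (n + a : ℂ) ^ s) =
      (((n + 1 : ℕ) + a : ℝ) : ℂ) ^ (1 - s) - ((n + a : ℝ) : ℂ) ^ (1 - s) := by
    rw [hurwitzTerm, Complex.cpow_neg, one_div]
    push_cast
    rw [add_right_comm (n : ℂ) a 1]
    ring
  have h4 := h3.tendsto_sum_nat
  simp_rw [hterm, Finset.sum_range_sub (fun n : ℕ ↦ ((n + a : ℝ) : ℂ) ^ (1 - s))] at h4
  have h5 : Tendsto (fun n : ℕ ↦ ((n + a : ℝ) : ℂ) ^ (1 - s)) atTop (𝓝 0) := by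
    rw [tendsto_zero_iff_norm_tendsto_zero]
    have : Tendsto (fun n : ℕ ↦ (n + a : ℝ) ^ (-(s.re - 1))) atTop (𝓝 0) :=
      (tendsto_rpow_neg_atTop (by linarith)).comp
        (tendsto_atTop_add_const_right _ _ tendsto_natCast_atTop_atTop)
    refine this.congr fun n ↦ ?_
    rw [Complex.norm_cpow_eq_rpow_re_of_pos (by positivity)]
    simp
  have h6 := tendsto_nhds_unique h4 (h5.sub_const _)
  rw [sub_eq_iff_eq_add] at h6
  rw [h6]
  simp
  ring

lemma tsum_hurwitzTerm {a : ℝ} (ha : 0 < a) (ha' : a ≤ 1) {s : ℂ} (hs : 0 < s.re) (hs1 : s ≠ 1) :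
    ∑' n : ℕ, hurwitzTerm (n + a) s =
      (s - 1) * hurwitzZeta (a : UnitAddCircle) s - (a : ℂ) ^ (1 - s) := by
  let H : Set ℂ := {s | 0 < s.re}
  have hH : IsOpen H := isOpen_lt continuous_const Complex.continuous_re
  let G : ℂ → ℂ := fun s ↦ (s - 1) * (hurwitzZeta (a : UnitAddCircle) s - 1 / (s - 1) / s.Gammaℝ)
    + (s.Gammaℝ)⁻¹ - (a : ℂ) ^ (1 - s)
  have hG {s : ℂ} (hs : s ≠ 1) :
      G s = (s - 1) * hurwitzZeta (a : UnitAddCircle) s - (a : ℂ) ^ (1 - s) := by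
    have : s - 1 ≠ 0 := sub_ne_zero.mpr hs
    have h : (s - 1) * (1 / (s - 1) / s.Gammaℝ) = (s.Gammaℝ)⁻¹ := by
      rw [div_div, mul_one_div, div_mul_eq_div_div, div_self this, one_div]
    simp only [G, mul_sub, h]
    ring
  have ha0 : (a : ℂ) ≠ 0 := by exact_mod_cast ha.ne'
  have hdiff : Differentiable ℂ G := by
    intro s
    refine (DifferentiableAt.add (DifferentiableAt.mul (by fun_prop) ?_)
      Complex.differentiable_Gammaℝ_inv.differentiableAt).sub
      (DifferentiableAt.const_cpow (by fun_prop) (Or.inl ha0))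
    rcases eq_or_ne s 1 with rfl | h
    · exact differentiableAt_hurwitzZeta_sub_one_div _
    · have : s - 1 ≠ 0 := sub_ne_zero.mpr h
      have h1 : DifferentiableAt ℂ (fun s : ℂ ↦ 1 / (s - 1)) s := by
        fun_prop (disch := assumption)
      simp_rw [div_eq_mul_inv _ (Complex.Gammaℝ _)]
      exact (differentiableAt_hurwitzZeta _ h).sub
        (h1.mul Complex.differentiable_Gammaℝ_inv.differentiableAt)
  have hEq : EqOn (fun s ↦ ∑' n : ℕ, hurwitzTerm (n + a) s) G H := by
    have hana := (differentiableOn_tsum_hurwitzTerm ha).analyticOnNhd hH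
    refine hana.eqOn_of_preconnected_of_eventuallyEq
      (hdiff.differentiableOn.analyticOnNhd hH)
      (convex_halfSpace_re_gt 0).isPreconnected (z₀ := 2) (show 0 < (2 : ℂ).re by simp) ?_
    filter_upwards [(isOpen_lt continuous_const Complex.continuous_re).mem_nhds
      (by simp : (2 : ℂ) ∈ {s : ℂ | 1 < s.re})] with s (hs : 1 < s.re)
    rw [tsum_hurwitzTerm_of_one_lt_re ha ha' hs, hG]
    rintro rfl
    simp at hs
  rw [← hG hs1]
  exact hEq hs

lemma hurwitzTerm_ofReal {b : ℝ} (hb : 0 < b) (σ : ℝ) :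
    hurwitzTerm b σ =
      (((σ - 1) * b ^ (-σ) + (b + 1) ^ (1 - σ) - b ^ (1 - σ) : ℝ) : ℂ) := by
  push_cast [hurwitzTerm, Complex.ofReal_cpow hb.le,
    Complex.ofReal_cpow (by positivity : 0 ≤ b + 1)]
  rfl

/-- For real `σ > 0`, `σ ≠ 1`, the Hurwitz zeta value is real and given by the Euler–Maclaurin
series. -/
lemma exists_hurwitzZeta_eq_ofReal {a : ℝ} (ha : 0 < a) (ha' : a ≤ 1) {σ : ℝ} (hσ : 0 < σ)
    (hσ1 : σ ≠ 1) : ∃ r : ℝ, hurwitzZeta (a : UnitAddCircle) σ = r ∧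
      HasSum (fun n : ℕ ↦ (σ - 1) * (n + a) ^ (-σ) + ((n + 1 : ℕ) + a) ^ (1 - σ)
        - (n + a) ^ (1 - σ)) ((σ - 1) * r - a ^ (1 - σ)) := by
  have hre : 0 < (σ : ℂ).re := by simpa
  have h1 := (summable_hurwitzTerm ha hre).hasSum
  rw [tsum_hurwitzTerm ha ha' hre (by exact_mod_cast hσ1)] at h1
  simp_rw [fun n : ℕ ↦ hurwitzTerm_ofReal (by positivity : (0 : ℝ) < n + a) σ] at h1
  obtain ⟨S, hS⟩ := Complex.summable_ofReal.mp h1.summable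
  have h2 := h1.unique (Complex.hasSum_ofReal.mpr hS)
  have hne : ((σ : ℂ) - 1) ≠ 0 := sub_ne_zero.mpr (by exact_mod_cast hσ1)
  refine ⟨(S + a ^ (1 - σ)) / (σ - 1), ?_, ?_⟩
  · push_cast [Complex.ofReal_cpow ha.le]
    rw [eq_div_iff hne, ← h2]
    ring
  · rw [mul_div_cancel₀ _ (sub_ne_zero.mpr hσ1), add_sub_cancel_right]
    convert! hS using 2 with n
    push_cast
    rw [add_right_comm (n : ℝ) a 1]

lemma one_lt_hurwitz_bounds {a : ℝ} (ha : 0 < a) {σ r : ℝ} (hσ : 1 < σ) (hσ' : σ ≤ 2)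
    (hr : HasSum (fun n : ℕ ↦ (σ - 1) * (n + a) ^ (-σ) + ((n + 1 : ℕ) + a) ^ (1 - σ)
        - (n + a) ^ (1 - σ)) ((σ - 1) * r - a ^ (1 - σ))) :
    a ^ (1 - σ) / (σ - 1) ≤ r ∧ r ≤ a ^ (1 - σ) / (σ - 1) + a ^ (-σ) := by
  have hσ1 : 0 < σ - 1 := by linarith
  have tangent {b x : ℝ} (hb : 0 < b) (hx : 0 < x) (hxb : x ≠ b) :
      b ^ (1 - σ) - (σ - 1) * (x - b) * b ^ (-σ) < x ^ (1 - σ) := by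
    have := Real.tangent_lt_rpow_neg hσ1 (by linarith) hb hx hxb
    rwa [show -(σ - 1) = 1 - σ by ring, show 1 - σ - 1 = -σ by ring] at this
  constructor
  · rw [div_le_iff₀ hσ1]
    have := hr.nonneg fun n ↦ by
      have hb : (0 : ℝ) < n + a := by positivity
      have := tangent hb (by positivity : (0 : ℝ) < (n + 1 : ℕ) + a) (by push_cast; linarith)
      push_cast at this ⊢
      linarith
    linarith
  · have := hr.le_of_le_sub_succ (g := fun n ↦ (σ - 1) * (n + a : ℝ) ^ (-σ))
      (fun n ↦ by
        have hb : (0 : ℝ) < n + a := by positivity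
        have := tangent (by positivity : (0 : ℝ) < (n + 1 : ℕ) + a) hb (by push_cast; linarith)
        push_cast at this ⊢
        linarith)
      fun ε hε ↦ Eventually.of_forall fun n ↦ by
        have : 0 ≤ (σ - 1) * (n + a : ℝ) ^ (-σ) := by positivity
        linarith
    simp only [Nat.cast_zero, zero_add] at this
    rw [← sub_le_iff_le_add, le_div_iff₀ hσ1]
    linarith

lemma hurwitz_neg_of_half_le {a : ℝ} (ha : 1 / 2 ≤ a) {σ r : ℝ} (hσ : 0 < σ) (hσ' : σ < 1)
    (hr : HasSum (fun n : ℕ ↦ (σ - 1) * (n + a) ^ (-σ) + ((n + 1 : ℕ) + a) ^ (1 - σ)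
        - (n + a) ^ (1 - σ)) ((σ - 1) * r - a ^ (1 - σ))) : r < 0 := by
  have := hr.neg.lt_of_lt_sub_succ
    (g := fun n ↦ (n + a : ℝ) ^ (1 - σ) - (n + a - 1 / 2 : ℝ) ^ (1 - σ))
    (fun n ↦ by
      have hb : (1 / 2 : ℝ) ≤ n + a := by linarith [n.cast_nonneg (α := ℝ)]
      have := Real.midpoint_lt_sub_rpow hσ hσ' hb
      push_cast
      rw [show (n + 1 + a - 1 / 2 : ℝ) = n + a + 1 / 2 by ring]
      linarith)
    fun n ↦ by
      have hb : (1 / 2 : ℝ) ≤ n + a := by linarith [n.cast_nonneg (α := ℝ)]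
      exact sub_nonneg.mpr (Real.rpow_le_rpow (by linarith) (by linarith) (by linarith))
  have h0 := Real.rpow_nonneg (by linarith : 0 ≤ a - 1 / 2) (1 - σ)
  simp only [Nat.cast_zero, zero_add] at this
  by_contra! h
  nlinarith

lemma hurwitz_pos_of_lt {a : ℝ} (ha : 0 < a) {σ r : ℝ} (hσ : 0 < σ) (hσ' : σ < 1 - 2 * a)
    (hr : HasSum (fun n : ℕ ↦ (σ - 1) * (n + a) ^ (-σ) + ((n + 1 : ℕ) + a) ^ (1 - σ)
        - (n + a) ^ (1 - σ)) ((σ - 1) * r - a ^ (1 - σ))) : 0 < r := by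
  have hlim : Tendsto (fun n : ℕ ↦ -((1 - σ) / 2) * (n + a : ℝ) ^ (-σ)) atTop (𝓝 0) := by
    simpa using ((tendsto_rpow_neg_atTop hσ).comp
      (tendsto_atTop_add_const_right _ a tendsto_natCast_atTop_atTop)).const_mul (-((1 - σ) / 2))
  have := hr.le_of_le_sub_succ (g := fun n ↦ -((1 - σ) / 2) * (n + a : ℝ) ^ (-σ))
    (fun n ↦ by
      have := Real.sub_rpow_le_trapezoid hσ (by linarith) (by positivity : (0 : ℝ) < n + a)
      push_cast
      rw [add_right_comm (n : ℝ) 1 a]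
      linarith)
    fun ε hε ↦ by
      filter_upwards [hlim.eventually (lt_mem_nhds (neg_lt_zero.mpr hε))] with n hn using hn.le
  simp only [Nat.cast_zero, zero_add] at this
  rw [show 1 - σ = -σ + 1 by ring, Real.rpow_add_one ha.ne'] at this
  have h0 := Real.rpow_pos_of_pos ha (-σ)
  by_contra! h
  nlinarith
/-- `Phi0` at a real argument, as a real number. -/
noncomputable def realPhi0 (σ lam a : ℝ) : ℝ :=
  σ * ∫ x in Ioi lam, (x - (⌊x⌋ : ℝ) - 1 / 2) / (x + a) ^ (σ + 1)

lemma Phi0_ofReal {lam a : ℝ} (h : 0 < lam + a) (σ : ℝ) : Phi0 σ lam a = realPhi0 σ lam a := by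
  rw [Phi0, realPhi0, Complex.ofReal_mul, ← integral_complex_ofReal]
  congr 1
  refine MeasureTheory.setIntegral_congr_fun measurableSet_Ioi fun x (hx : lam < x) ↦ ?_
  have : 0 ≤ x + a := by linarith
  push_cast [Complex.ofReal_cpow this]
  rfl

lemma abs_realPhi0_le {lam a : ℝ} (h : 0 < lam + a) {σ : ℝ} (hσ : 0 < σ) :
    |realPhi0 σ lam a| ≤ (lam + a) ^ (-σ) / 2 := by
  have hint : MeasureTheory.IntegrableOn (fun x : ℝ ↦ 1 / 2 * (x + a) ^ (-σ - 1)) (Ioi lam) :=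
    (integrableOn_add_rpow_Ioi_of_lt (by linarith) (by linarith)).const_mul _
  have hval : ∫ x in Ioi lam, 1 / 2 * (x + a) ^ (-σ - 1) = (lam + a) ^ (-σ) / (2 * σ) := by
    have hshift := (MeasureTheory.measurePreserving_add_right MeasureTheory.volume
      a).setIntegral_preimage_emb (measurableEmbedding_addRight a)
      (fun x : ℝ ↦ x ^ (-σ - 1)) (Ioi (lam + a))
    rw [preimage_add_const_Ioi, add_sub_cancel_right] at hshift
    rw [MeasureTheory.integral_const_mul, hshift,
      integral_Ioi_rpow_of_lt (by linarith) h, sub_add_cancel]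
    field_simp
  have hbound : |∫ x in Ioi lam, (x - (⌊x⌋ : ℝ) - 1 / 2) / (x + a) ^ (σ + 1)| ≤
      (lam + a) ^ (-σ) / (2 * σ) := by
    rw [← hval, ← Real.norm_eq_abs]
    refine MeasureTheory.norm_integral_le_of_norm_le hint ?_
    refine (MeasureTheory.ae_restrict_iff' measurableSet_Ioi).mpr (.of_forall fun x hx ↦ ?_)
    have hxa : 0 < x + a := by linarith [mem_Ioi.mp hx]
    have hfr : |x - (⌊x⌋ : ℝ) - 1 / 2| ≤ 1 / 2 := by
      rw [abs_le]
      constructor <;> linarith [Int.floor_le x, Int.lt_floor_add_one x]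
    rw [norm_div, Real.norm_eq_abs, Real.norm_of_nonneg (by positivity),
      show -σ - 1 = -(σ + 1) by ring, Real.rpow_neg hxa.le, ← div_eq_mul_inv]
    gcongr
  rw [realPhi0, abs_mul, abs_of_pos hσ]
  calc σ * _ ≤ σ * ((lam + a) ^ (-σ) / (2 * σ)) := by gcongr
    _ = _ := by field_simp

lemma hasSum_hurwitzZeta_re {a : ℝ} (ha : 0 < a) (ha' : a ≤ 1) {σ : ℝ} (hσ : 1 < σ) :
    HasSum (fun n : ℕ ↦ ((n + 1 : ℕ) + a) ^ (-σ))
      ((hurwitzZeta (a : UnitAddCircle) σ).re - a ^ (-σ)) := by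
  have h1 := Complex.hasSum_re (hasSum_hurwitzZeta_of_one_lt_re ⟨ha.le, ha'⟩
    (by simpa : 1 < (σ : ℂ).re))
  have hterm (n : ℕ) : (1 / (n + a : ℂ) ^ (σ : ℂ)).re = (n + a : ℝ) ^ (-σ) := by
    have : (0 : ℝ) ≤ n + a := by positivity
    rw [Real.rpow_neg this, ← one_div, ← Complex.ofReal_re (1 / _)]
    push_cast [Complex.ofReal_cpow this]
    rfl
  simp_rw [hterm] at h1
  simpa using (hasSum_nat_add_iff' (f := fun n : ℕ ↦ (n + a : ℝ) ^ (-σ)) 1).mpr h1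

lemma abs_realPhi0_mul_rpow_le {a : ℝ} (ha : 0 < a) {σ₁ σ₂ : ℝ} (hσ₂ : 0 < σ₂) (n : ℕ) :
    |realPhi0 σ₂ (n + 1 : ℕ) a * ((n + 1 : ℕ) + a) ^ (-σ₁)| ≤
      ((n + 1 : ℕ) + a) ^ (-(σ₁ + σ₂)) / 2 := by
  have hb : (0 : ℝ) < (n + 1 : ℕ) + a := by positivity
  rw [abs_mul, abs_of_nonneg (Real.rpow_nonneg hb.le _),
    show -(σ₁ + σ₂) = -σ₂ + -σ₁ by ring, Real.rpow_add hb, mul_div_right_comm]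
  gcongr
  exact abs_realPhi0_le hb hσ₂

/-- The value of `doubleZetaCont` at a real point. -/
noncomputable def realDoubleZeta (a σ₁ σ₂ : ℝ) : ℝ :=
  a ^ (-σ₁) * ((hurwitzZeta (a : UnitAddCircle) σ₂).re - a ^ (-σ₂)) +
    ((hurwitzZeta (a : UnitAddCircle) (σ₁ + σ₂ - 1 : ℝ)).re - a ^ (1 - σ₁ - σ₂)) / (σ₂ - 1) -
    ((hurwitzZeta (a : UnitAddCircle) (σ₁ + σ₂ : ℝ)).re - a ^ (-σ₁ - σ₂)) / 2 -
    ∑' n : ℕ, realPhi0 σ₂ (n + 1 : ℕ) a * ((n + 1 : ℕ) + a) ^ (-σ₁)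

lemma doubleZetaCont_ofReal {a : ℝ} (ha : 0 < a) (ha' : a ≤ 1) {σ₁ σ₂ : ℝ} (hσ₂ : 1 < σ₂)
    (h1 : 1 < σ₁ + σ₂) (h2 : σ₁ + σ₂ < 2) :
    doubleZetaCont a σ₁ σ₂ = realDoubleZeta a σ₁ σ₂ := by
  have hre {σ : ℝ} (hσ : 0 < σ) (hσ1 : σ ≠ 1) : hurwitzZeta (a : UnitAddCircle) (σ : ℂ) =
      ((hurwitzZeta (a : UnitAddCircle) (σ : ℂ)).re : ℂ) := by
    obtain ⟨r, hr, -⟩ := exists_hurwitzZeta_eq_ofReal ha ha' hσ hσ1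
    rw [hr, Complex.ofReal_re]
  have hterm (n : ℕ) : Phi0 σ₂ (n + 1 : ℕ) a * (((n : ℂ) + 1) + a) ^ (-(σ₁ : ℂ)) =
      ((realPhi0 σ₂ (n + 1 : ℕ) a * ((n + 1 : ℕ) + a) ^ (-σ₁) : ℝ) : ℂ) := by
    have hb : (0 : ℝ) < (n + 1 : ℕ) + a := by positivity
    rw [Phi0_ofReal hb, Complex.ofReal_mul, Complex.ofReal_cpow hb.le]
    push_cast
    rfl
  rw [doubleZetaCont, realDoubleZeta]
  simp_rw [hterm]
  rw [← Complex.ofReal_tsum, hre (by linarith : 0 < σ₂) hσ₂.ne',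
    show (σ₁ + σ₂ - 1 : ℂ) = ((σ₁ + σ₂ - 1 : ℝ) : ℂ) by push_cast; rfl,
    show (σ₁ + σ₂ : ℂ) = ((σ₁ + σ₂ : ℝ) : ℂ) by push_cast; rfl,
    hre (by linarith : 0 < σ₁ + σ₂ - 1) (by linarith), hre (by linarith : 0 < σ₁ + σ₂) h1.ne']
  push_cast [Complex.ofReal_cpow ha.le]
  rfl

lemma realDoubleZeta_bounds {a : ℝ} (ha : 0 < a) (ha' : a ≤ 1) {σ₁ σ₂ : ℝ} (hσ₂ : 1 < σ₂)
    (hσ₂' : σ₂ ≤ 2) (h1 : 1 < σ₁ + σ₂) :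
    (hurwitzZeta (a : UnitAddCircle) (σ₁ + σ₂ - 1 : ℝ)).re / (σ₂ - 1) -
        (hurwitzZeta (a : UnitAddCircle) (σ₁ + σ₂ : ℝ)).re ≤ realDoubleZeta a σ₁ σ₂ ∧
      realDoubleZeta a σ₁ σ₂ ≤
        (hurwitzZeta (a : UnitAddCircle) (σ₁ + σ₂ - 1 : ℝ)).re / (σ₂ - 1) := by
  obtain ⟨r, hr, hsum⟩ := exists_hurwitzZeta_eq_ofReal ha ha' (by linarith : 0 < σ₂) hσ₂.ne'
  obtain ⟨hlo, hhi⟩ := one_lt_hurwitz_bounds ha hσ₂ hσ₂' hsum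
  have htail := tsum_of_norm_bounded
    (f := fun n : ℕ ↦ realPhi0 σ₂ (n + 1 : ℕ) a * ((n + 1 : ℕ) + a) ^ (-σ₁))
    ((hasSum_hurwitzZeta_re ha ha' h1).div_const 2)
    fun n ↦ abs_realPhi0_mul_rpow_le ha (σ₁ := σ₁) (by linarith : 0 < σ₂) n
  rw [Real.norm_eq_abs, abs_le] at htail
  have hpos := Real.rpow_pos_of_pos ha (-σ₁)
  have e1 : a ^ (-σ₁) * a ^ (-σ₂) = a ^ (-σ₁ - σ₂) := by
    rw [← Real.rpow_add ha, ← sub_eq_add_neg]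
  have e2 : a ^ (-σ₁) * (a ^ (1 - σ₂) / (σ₂ - 1)) = a ^ (1 - σ₁ - σ₂) / (σ₂ - 1) := by
    rw [← mul_div_assoc, ← Real.rpow_add ha]
    ring_nf
  have e3 : a ^ (-(σ₁ + σ₂)) = a ^ (-σ₁ - σ₂) := by ring_nf
  have hlo' := mul_le_mul_of_nonneg_left hlo hpos.le
  have hhi' := mul_le_mul_of_nonneg_left hhi hpos.le
  rw [mul_add] at hhi'
  rw [e3] at htail
  rw [realDoubleZeta, hr, Complex.ofReal_re, sub_div, mul_sub]
  constructor <;> linarith [htail.1, htail.2]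

lemma continuousAt_hurwitzZeta_re (a : UnitAddCircle) {σ : ℝ} (hσ : σ ≠ 1) :
    ContinuousAt (fun x : ℝ ↦ (hurwitzZeta a x).re) σ :=
  Complex.continuous_re.continuousAt.comp
    ((differentiableAt_hurwitzZeta a (by exact_mod_cast hσ)).continuousAt.comp
      Complex.continuous_ofReal.continuousAt)

lemma continuousOn_realDoubleZeta {a : ℝ} (ha : 0 < a) (ha' : a ≤ 1) {σ₂ u v : ℝ} (hσ₂ : 1 < σ₂)
    (hu : 1 < u + σ₂) (hv : v + σ₂ < 2) :
    ContinuousOn (fun σ₁ ↦ realDoubleZeta a σ₁ σ₂) (Icc u v) := by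
  have hz (c : ℝ) (hc : ∀ x ∈ Icc u v, x + c ≠ 1) :
      ContinuousOn (fun x : ℝ ↦ (hurwitzZeta (a : UnitAddCircle) (x + c : ℝ)).re) (Icc u v) :=
    fun x hx ↦ (ContinuousAt.comp (f := fun x : ℝ ↦ x + c)
      (continuousAt_hurwitzZeta_re _ (hc x hx)) (by fun_prop)).continuousWithinAt
  have hz1 := hz σ₂ fun x hx ↦ by linarith [hx.1]
  have hz2 := hz (σ₂ - 1) fun x hx ↦ by linarith [hx.2]
  simp_rw [← add_sub_assoc] at hz2
  have htsum : ContinuousOn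
      (fun x : ℝ ↦ ∑' n : ℕ, realPhi0 σ₂ (n + 1 : ℕ) a * ((n + 1 : ℕ) + a) ^ (-x)) (Icc u v) := by
    refine continuousOn_tsum (fun n ↦ ?_) ((hasSum_hurwitzZeta_re ha ha' hu).div_const 2).summable
      fun n x hx ↦ (abs_realPhi0_mul_rpow_le ha (by linarith) n).trans ?_
    · fun_prop (disch := positivity)
    · have hb : (1 : ℝ) ≤ (n + 1 : ℕ) + a := by
        push_cast
        linarith [n.cast_nonneg (α := ℝ)]
      gcongr
      exact hx.1
  unfold realDoubleZeta
  fun_prop (disch := positivity)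

lemma eventually_hurwitzZeta_re_neg (a : UnitAddCircle) :
    ∀ᶠ σ : ℝ in 𝓝[<] 1, (hurwitzZeta a σ).re < 0 := by
  have hmap : Tendsto (fun σ : ℝ ↦ (σ : ℂ)) (𝓝[<] 1) (𝓝[≠] 1) := by
    refine tendsto_nhdsWithin_iff.mpr ⟨?_, ?_⟩
    · exact (Complex.continuous_ofReal.tendsto' 1 1 (by simp)).mono_left nhdsWithin_le_nhds
    · filter_upwards [self_mem_nhdsWithin] with σ (hσ : σ < 1)
      exact Complex.ofReal_ne_one.mpr hσ.ne
  have h1 := (Complex.continuous_re.tendsto 1).comp ((hurwitzZeta_residue_one a).comp hmap)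
  filter_upwards [h1.eventually (lt_mem_nhds (by simp : 0 < (1 : ℂ).re)), self_mem_nhdsWithin]
    with σ hσ (hσ1 : σ < 1)
  have : (((σ : ℂ) - 1) * hurwitzZeta a σ).re = (σ - 1) * (hurwitzZeta a σ).re := by
    rw [← Complex.re_ofReal_mul]
    push_cast
    rfl
  simp only [Function.comp_apply, this] at hσ
  exact neg_of_mul_pos_right hσ (by linarith)

theorem doubleZetaCont_ne_zero_iff (a : ℝ) (ha : 0 < a) (ha' : a ≤ 1) :
    (∀ σ₁ σ₂ : ℝ, 0 < σ₁ → σ₁ < 1 → 1 < σ₂ → 1 < σ₁ + σ₂ → σ₁ + σ₂ < 2 →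
      doubleZetaCont a σ₁ σ₂ ≠ 0) ↔ 1 / 2 ≤ a := by
  constructor
  · intro h
    by_contra! hlt
    obtain ⟨u, hu0, hu⟩ := exists_between (by linarith : 0 < 1 - 2 * a)
    have hzu : 0 < (hurwitzZeta (a : UnitAddCircle) u).re := by
      obtain ⟨r, hr, hsum⟩ := exists_hurwitzZeta_eq_ofReal ha ha' hu0 (by linarith)
      rw [hr, Complex.ofReal_re]
      exact hurwitz_pos_of_lt ha hu0 hu hsum
    obtain ⟨v, hzv, huv, hv1⟩ := ((eventually_hurwitzZeta_re_neg (a : UnitAddCircle)).and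
      (Ioo_mem_nhdsLT (by linarith : u < 1))).exists
    have hlim : Tendsto (fun δ : ℝ ↦ δ * (hurwitzZeta (a : UnitAddCircle) (u + 1 : ℝ)).re)
        (𝓝[>] 0) (𝓝 0) :=
      ((continuous_mul_const _).tendsto' 0 0 (zero_mul _)).mono_left nhdsWithin_le_nhds
    obtain ⟨δ, ⟨hδ, hδ0, hδu⟩, -, hδv⟩ := ((hlim.eventually (gt_mem_nhds hzu)).and
      (Ioo_mem_nhdsGT hu0) |>.and (Ioo_mem_nhdsGT (by linarith : 0 < 1 - v))).exists
    have hpos : 0 ≤ realDoubleZeta a (u - δ) (1 + δ) := by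
      have := (realDoubleZeta_bounds ha ha' (σ₁ := u - δ) (by linarith : 1 < 1 + δ) (by linarith)
        (by linarith)).1
      rw [show u - δ + (1 + δ) - 1 = u by ring, show u - δ + (1 + δ) = u + 1 by ring,
        add_sub_cancel_left] at this
      refine le_trans (sub_nonneg.mpr ?_) this
      rw [le_div_iff₀ hδ0]
      linarith
    have hneg : realDoubleZeta a (v - δ) (1 + δ) ≤ 0 := by
      have := (realDoubleZeta_bounds ha ha' (σ₁ := v - δ) (by linarith : 1 < 1 + δ) (by linarith)
        (by linarith)).2
      rw [show v - δ + (1 + δ) - 1 = v by ring, add_sub_cancel_left] at this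
      exact this.trans (div_nonpos_of_nonpos_of_nonneg hzv.le hδ0.le)
    obtain ⟨σ₁, hσ₁, hzero⟩ := intermediate_value_Icc' (by linarith : u - δ ≤ v - δ)
      (continuousOn_realDoubleZeta ha ha' (by linarith : 1 < 1 + δ) (by linarith) (by linarith))
      ⟨hneg, hpos⟩
    refine h σ₁ (1 + δ) (by linarith [hσ₁.1]) (by linarith [hσ₁.2]) (by linarith)
      (by linarith [hσ₁.1]) (by linarith [hσ₁.2]) ?_
    rw [doubleZetaCont_ofReal ha ha' (by linarith) (by linarith [hσ₁.1]) (by linarith [hσ₁.2])]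
    exact_mod_cast hzero
  · intro hhalf σ₁ σ₂ hσ₁ hσ₁' hσ₂ h1 h2
    rw [doubleZetaCont_ofReal ha ha' hσ₂ h1 h2, Complex.ofReal_ne_zero]
    have hσ : 0 < σ₁ + σ₂ - 1 := by linarith
    obtain ⟨r, hr, hsum⟩ := exists_hurwitzZeta_eq_ofReal ha ha' hσ (by linarith)
    have hr0 := hurwitz_neg_of_half_le hhalf hσ (by linarith) hsum
    have hle := (realDoubleZeta_bounds ha ha' hσ₂ (by linarith) h1).2
    rw [hr, Complex.ofReal_re] at hle
    exact (hle.trans_lt (div_neg_of_neg_of_pos hr0 (by linarith))).ne
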